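/- (Lemma 2) Let R = 3·max_{1≤i≤L} ‖a_i‖ + max_{1≤i≤L} d_i + 1, C₁ = 1/2, and C₂ = 1. Then for every index i and every x ∈ ℝⁿ with ‖x‖ ≥ R, the vector g = sign(‖x − a_i‖ − d_i)·(x − a_i)/(L·‖x − a_i‖) is well defined and nonzero, and it satisfies ⟨g/‖g‖, x/‖x‖⟩ ≥ C₁ and ‖g‖ ≤ C₂·‖x‖. -/

import Mathlib

open RealInnerProductSpace

/-- Lemma 2 of the paper: with
`R = 3·max_i ‖a_i‖ + max_i d_i + 1`, `C₁ = 1/2` and `C₂ = 1`, for every `i` and every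
`x` with `‖x‖ ≥ R`, the DSRL subgradient element
`g = sign(‖x − a_i‖ − d_i) · (x − a_i) / (L·‖x − a_i‖)` is well defined (`x ≠ a_i`)
and nonzero, and it satisfies `⟨g/‖g‖, x/‖x‖⟩ ≥ C₁` and `‖g‖ ≤ C₂·‖x‖`. -/
theorem dsrl_subgradient_lemma2
    (n L : ℕ) (hn : 0 < n) (hL : 0 < L)
    (a : Fin L → EuclideanSpace ℝ (Fin n)) (d : Fin L → ℝ)
    (hd : ∀ i, 0 < d i)
    (R C₁ C₂ : ℝ)
    (hR : R = 3 * (⨆ i, ‖a i‖) + (⨆ i, d i) + 1)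
    (hC₁ : C₁ = 1 / 2) (hC₂ : C₂ = 1) :
    ∀ (i : Fin L) (x : EuclideanSpace ℝ (Fin n)), ‖x‖ ≥ R →
      ∀ g : EuclideanSpace ℝ (Fin n),
        g = (Real.sign (‖x - a i‖ - d i) / ((L : ℝ) * ‖x - a i‖)) • (x - a i) →
          x ≠ a i ∧ g ≠ 0 ∧
          ⟪‖g‖⁻¹ • g, ‖x‖⁻¹ • x⟫ ≥ C₁ ∧
          ‖g‖ ≤ C₂ * ‖x‖ := by
  intro i x hx g hg
  have h1 : ‖a i‖ ≤ ⨆ i, ‖a i‖ := le_ciSup (f := fun i => ‖a i‖) (Set.finite_range _).bddAbove i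
  have h2 : d i ≤ ⨆ i, d i := le_ciSup (Set.finite_range _).bddAbove i
  have hX : 3 * ‖a i‖ + d i + 1 ≤ ‖x‖ := by linarith
  have hA := norm_nonneg (a i)
  have hdi := hd i
  have hr1 : ‖x‖ - ‖a i‖ ≤ ‖x - a i‖ := norm_sub_norm_le _ _
  have hr2 : ‖x - a i‖ ≤ ‖x‖ + ‖a i‖ := norm_sub_le _ _
  have hr : 0 < ‖x - a i‖ := by linarith
  have hx0 : 0 < ‖x‖ := by linarith
  have hL1 : (1 : ℝ) ≤ L := by exact_mod_cast hL
  have hL0 : (0 : ℝ) < L := by linarith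
  rw [Real.sign_of_pos (by linarith)] at hg
  have hgn : ‖g‖ = (L : ℝ)⁻¹ := by
    rw [hg, norm_smul, Real.norm_of_nonneg (by positivity)]
    field_simp
  have hgg : ‖g‖⁻¹ • g = ‖x - a i‖⁻¹ • (x - a i) := by
    rw [hgn, hg, smul_smul]
    congr 1
    field_simp
  refine ⟨?_, ?_, ?_, ?_⟩
  · intro h
    rw [h] at hr
    simp at hr
  · rw [← norm_pos_iff, hgn]
    positivity
  · rw [hgg, real_inner_smul_left, real_inner_smul_right, inner_sub_left,
      real_inner_self_eq_norm_sq, hC₁, ge_iff_le]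
    have hin := real_inner_le_norm (a i) x
    rw [← mul_assoc, ← mul_inv, inv_mul_eq_div, div_le_div_iff₀ (by norm_num) (by positivity)]
    nlinarith
  · rw [hgn, hC₂]
    have : (L : ℝ)⁻¹ ≤ 1 := inv_le_one_of_one_le₀ hL1
    linarith
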